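/- Let (X, Y) have joint density ρ(x,y) = ρ₀(x) p_τ(x,y), and define the Perron–Frobenius operator T_τ h(y) = E[h(X) | Y = y] and the reduced operator T_D h(y) = E[h(X) | r(Y) = r(y)]. Then T_D = T_τ (equality ρ₁-almost everywhere for all bounded measurable h) if and only if decomposability holds, i.e., the backward density p_{-τ}(y,x) = ρ₀(x)p_τ(x,y)/ρ₁(y) depends on y only through r(y). -/

import Mathlib

open MeasureTheory ProbabilityTheory

namespace ProbabilityTheory

variable {Ω E F G : Type*} [MeasurableSpace Ω] [MeasurableSpace E] [MeasurableSpace F]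
  [MeasurableSpace G] [StandardBorelSpace E] [Nonempty E] {μ : Measure Ω} {X : Ω → E} {Y : Ω → F}
  {r : F → G}

/-- If conditioning events of `X` on `Y` is the same as conditioning them on `r ∘ Y`, then the
regular conditional distribution of `X` given `Y` factors through `r`. -/
theorem condDistrib_ae_eq_comap_of_condExp_ae_eq [IsFiniteMeasure μ] (hX : Measurable X)
    (hY : Measurable Y) (hr : Measurable r)
    (h : ∀ t, MeasurableSet t → μ⟦X ⁻¹' t | MeasurableSpace.comap Y inferInstance⟧
      =ᵐ[μ] μ⟦X ⁻¹' t | MeasurableSpace.comap (fun ω => r (Y ω)) inferInstance⟧) :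
    condDistrib X Y μ =ᵐ[μ.map Y] (condDistrib X (fun ω => r (Y ω)) μ).comap r hr := by
  refine condDistrib_ae_eq_of_measure_eq_compProd Y hX.aemeasurable ?_
  rw [← compProd_map_condDistrib hX.aemeasurable]
  refine Measure.ext_prod fun {s t} hs ht => ?_
  rw [Measure.compProd_apply_prod hs ht, Measure.compProd_apply_prod hs ht]
  refine setLIntegral_congr_fun_ae hs ?_
  have key : ∀ᵐ y ∂(μ.map Y), condDistrib X Y μ y t
      = (condDistrib X (fun ω => r (Y ω)) μ).comap r hr y t := by
    rw [ae_map_iff hY.aemeasurable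
      (measurableSet_eq_fun (Kernel.measurable_coe _ ht) (Kernel.measurable_coe _ ht))]
    filter_upwards [h t ht, condDistrib_ae_eq_condExp (μ := μ) hY hX ht,
      condDistrib_ae_eq_condExp (μ := μ) (hr.comp hY) hX ht] with ω h₁ h₂ h₃
    rw [Kernel.comap_apply]
    exact (measureReal_eq_measureReal_iff).1 (h₂.trans (h₁.trans h₃.symm))
  filter_upwards [key] with y hy _ using hy

/-- If the regular conditional distribution of `X` given `Y` factors through `r`, then conditioning
functions of `X` on `Y` is the same as conditioning them on `r ∘ Y`. -/
theorem condExp_ae_eq_condExp_of_condDistrib_ae_eq_comap [IsFiniteMeasure μ] (hX : Measurable X)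
    (hY : Measurable Y) (hr : Measurable r) {η : Kernel G E} [IsSFiniteKernel η]
    (hη : condDistrib X Y μ =ᵐ[μ.map Y] η.comap r hr) {f : E → ℝ} (hf : StronglyMeasurable f)
    (hf_int : Integrable (fun ω => f (X ω)) μ) :
    μ[fun ω => f (X ω) | MeasurableSpace.comap Y inferInstance]
      =ᵐ[μ] μ[fun ω => f (X ω) | MeasurableSpace.comap (fun ω => r (Y ω)) inferInstance] := by
  have hle : MeasurableSpace.comap (fun ω => r (Y ω)) inferInstance
      ≤ MeasurableSpace.comap Y inferInstance := by
    rintro _ ⟨s, hs, rfl⟩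
    exact ⟨r ⁻¹' s, hr hs, rfl⟩
  have hY_eq : μ[fun ω => f (X ω) | MeasurableSpace.comap Y inferInstance]
      =ᵐ[μ] fun ω => ∫ x, f x ∂η (r (Y ω)) := by
    filter_upwards [condExp_ae_eq_integral_condDistrib hY hX.aemeasurable hf hf_int,
      ae_of_ae_map hY.aemeasurable hη] with ω h₁ h₂
    rw [h₁, h₂, Kernel.comap_apply]
  have hmeas : StronglyMeasurable[MeasurableSpace.comap (fun ω => r (Y ω)) inferInstance]
      fun ω => ∫ x, f x ∂η (r (Y ω)) :=
    (hf.integral_kernel (κ := η)).comp_measurable (comap_measurable fun ω => r (Y ω))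
  calc μ[fun ω => f (X ω) | MeasurableSpace.comap Y inferInstance]
      =ᵐ[μ] fun ω => ∫ x, f x ∂η (r (Y ω)) := hY_eq
    _ = μ[fun ω => ∫ x, f x ∂η (r (Y ω)) |
          MeasurableSpace.comap (fun ω => r (Y ω)) inferInstance] :=
        (condExp_of_stronglyMeasurable (hr.comp hY).comap_le hmeas
          (integrable_condExp.congr hY_eq)).symm
    _ =ᵐ[μ] μ[μ[fun ω => f (X ω) | MeasurableSpace.comap Y inferInstance] |
          MeasurableSpace.comap (fun ω => r (Y ω)) inferInstance] := condExp_congr_ae hY_eq.symm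
    _ =ᵐ[μ] _ := condExp_condExp_of_le hle hY.comap_le

end ProbabilityTheory

/-- A joint law with a density disintegrates along the second variable into the marginal density `b`
and the densities `f y` with respect to a reference measure with density `a`. -/
theorem MeasureTheory.Measure.map_prodMk_eq_withDensity_compProd
    {Ω E F : Type*} [MeasurableSpace Ω] [MeasurableSpace E] [MeasurableSpace F]
    {μ : Measure Ω} [IsFiniteMeasure μ] {X : Ω → E} {Y : Ω → F} (hX : Measurable X)
    (hY : Measurable Y) {m : Measure E} [SFinite m] {n : Measure F} [SFinite n]
    {a : E → ENNReal} (ha : Measurable a) {b : F → ENNReal} (hb : Measurable b)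
    {f : F → E → ENNReal} (hf : Measurable (Function.uncurry f)) {q : E × F → ENNReal}
    (hq : Measurable q) (hqf : ∀ x y, q (x, y) = b y * (a x * f y x))
    (hlaw : μ.map (fun ω => (X ω, Y ω)) = (m.prod n).withDensity q)
    [IsSFiniteKernel ((Kernel.const F (m.withDensity a)).withDensity f)] :
    μ.map (fun ω => (Y ω, X ω))
      = n.withDensity b ⊗ₘ (Kernel.const F (m.withDensity a)).withDensity f := by
  refine Measure.ext_prod fun {s t} hs ht => ?_
  have hswap : μ.map (fun ω => (Y ω, X ω)) (s ×ˢ t)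
      = μ.map (fun ω => (X ω, Y ω)) (t ×ˢ s) := by
    rw [Measure.map_apply (hY.prodMk hX) (hs.prod ht), Measure.map_apply (hX.prodMk hY) (ht.prod hs)]
    congr 1
    ext ω
    simp [and_comm]
  rw [hswap, hlaw, withDensity_apply _ (ht.prod hs), ← Measure.prod_restrict,
    lintegral_prod_symm' _ hq, Measure.compProd_apply_prod hs ht,
    setLIntegral_withDensity_eq_setLIntegral_mul _ hb (Kernel.measurable_coe _ ht) hs]
  refine lintegral_congr fun y => ?_
  have hfy : Measurable (f y) := hf.of_uncurry_left
  rw [Pi.mul_apply, Kernel.withDensity_apply' _ hf, Kernel.const_apply,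
    setLIntegral_withDensity_eq_setLIntegral_mul _ ha hfy ht]
  simp_rw [hqf]
  exact lintegral_const_mul _ (ha.mul hfy)

/-- The reduced Perron–Frobenius operator agrees with the full one
(`E[h(X)|Y] = E[h(X)|r(Y)]` a.e., for all bounded measurable `h`) if and only if
decomposability holds, i.e. the backward density
`p₋τ(y,x) = ρ₀(x)pτ(x,y)/ρ₁(y)` depends on `y` only through `r y`. -/
theorem reduced_pf_eq_iff_decomposable
    {D d : ℕ}
    {Ω : Type*} [MeasurableSpace Ω] (μ : Measure Ω) [IsProbabilityMeasure μ]
    (Xv Yv : Ω → EuclideanSpace ℝ (Fin D))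
    (hXv : Measurable Xv) (hYv : Measurable Yv)
    (r : EuclideanSpace ℝ (Fin D) → EuclideanSpace ℝ (Fin d)) (hr : Measurable r)
    (pτ : EuclideanSpace ℝ (Fin D) → EuclideanSpace ℝ (Fin D) → ℝ)
    (hpτ_meas : Measurable (Function.uncurry pτ))
    (hpτ_nonneg : ∀ x y, 0 ≤ pτ x y)
    (hpτ_norm : ∀ x, ∫ y, pτ x y = 1)
    (ρ₀ : EuclideanSpace ℝ (Fin D) → ℝ)
    (hρ₀_meas : Measurable ρ₀)
    (hρ₀_pos : ∀ x, 0 < ρ₀ x)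
    (hρ₀_norm : ∫ x, ρ₀ x = 1)
    (ρ₁ : EuclideanSpace ℝ (Fin D) → ℝ)
    (hρ₁_def : ∀ y, ρ₁ y = ∫ x, ρ₀ x * pτ x y)
    (hρ₁_pos : ∀ y, 0 < ρ₁ y)
    (pmτ : EuclideanSpace ℝ (Fin D) → EuclideanSpace ℝ (Fin D) → ℝ)
    (hpmτ_def : ∀ x y, pmτ y x = ρ₀ x * pτ x y / ρ₁ y)
    -- the joint law of (X, Y) has density ρ(x,y) = ρ₀(x) pτ(x,y)
    (hlaw : Measure.map (fun ω => (Xv ω, Yv ω)) μ =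
      (volume : Measure (EuclideanSpace ℝ (Fin D) × EuclideanSpace ℝ (Fin D))).withDensity
        (fun p => ENNReal.ofReal (ρ₀ p.1 * pτ p.1 p.2))) :
    (∀ h : EuclideanSpace ℝ (Fin D) → ℝ, Measurable h → (∃ C, ∀ x, |h x| ≤ C) →
        μ[(fun ω => h (Xv ω)) | MeasurableSpace.comap Yv inferInstance]
          =ᵐ[μ] μ[(fun ω => h (Xv ω)) | MeasurableSpace.comap (fun ω => r (Yv ω)) inferInstance])
      ↔
    (∃ pmτD : EuclideanSpace ℝ (Fin d) → EuclideanSpace ℝ (Fin D) → ℝ,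
      Measurable (Function.uncurry pmτD) ∧ (∀ z x, 0 ≤ pmτD z x) ∧
      ∀ᵐ p ∂((volume : Measure (EuclideanSpace ℝ (Fin D) × EuclideanSpace ℝ (Fin D))).withDensity
          (fun p => ENNReal.ofReal (ρ₁ p.1))),
        pmτ p.1 p.2 = pmτD (r p.1) p.2) := by
  have hjoint : Measurable fun p : EuclideanSpace ℝ (Fin D) × EuclideanSpace ℝ (Fin D) =>
      ρ₀ p.1 * pτ p.1 p.2 := (hρ₀_meas.comp measurable_fst).mul hpτ_meas
  have hρ₁_meas : Measurable ρ₁ := by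
    rw [funext hρ₁_def]
    exact hjoint.stronglyMeasurable.integral_prod_left.measurable
  have hρ₁_lint : ∀ y, ∫⁻ x, ENNReal.ofReal (ρ₀ x * pτ x y) = ENNReal.ofReal (ρ₁ y) := by
    intro y
    rw [hρ₁_def, ofReal_integral_eq_lintegral_ofReal]
    · exact Integrable.of_integral_ne_zero (hρ₁_def y ▸ (hρ₁_pos y).ne')
    · exact ae_of_all _ fun x => mul_nonneg (hρ₀_pos x).le (hpτ_nonneg x y)
  set a : EuclideanSpace ℝ (Fin D) → ENNReal := fun x => ENNReal.ofReal (ρ₀ x) with ha_def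
  have ha : Measurable a := hρ₀_meas.ennreal_ofReal
  have ha_pos : ∀ x, a x ≠ 0 := fun x => (ENNReal.ofReal_pos.2 (hρ₀_pos x)).ne'
  set f : EuclideanSpace ℝ (Fin D) → EuclideanSpace ℝ (Fin D) → ENNReal :=
    fun y x => ENNReal.ofReal (pτ x y / ρ₁ y) with hf_def
  have hf : Measurable (Function.uncurry f) :=
    ((hpτ_meas.comp measurable_swap).div (hρ₁_meas.comp measurable_fst)).ennreal_ofReal
  set m : Measure (EuclideanSpace ℝ (Fin D)) := volume.withDensity a with hm
  have : IsProbabilityMeasure m := by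
    refine ⟨?_⟩
    rw [hm, withDensity_apply _ .univ, setLIntegral_univ, ha_def,
      ← ofReal_integral_eq_lintegral_ofReal, hρ₀_norm, ENNReal.ofReal_one]
    · exact Integrable.of_integral_ne_zero (by simp [hρ₀_norm])
    · exact ae_of_all _ fun x => (hρ₀_pos x).le
  have hm_ae : ∀ {p : EuclideanSpace ℝ (Fin D) → Prop}, (∀ᵐ x ∂m, p x) ↔ ∀ᵐ x, p x := by
    intro p
    rw [hm, ae_withDensity_iff ha]
    simp [ha_pos]
  have hqf : ∀ x y, ENNReal.ofReal (ρ₀ x * pτ x y)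
      = ENNReal.ofReal (ρ₁ y) * (a x * f y x) := by
    intro x y
    rw [ha_def, hf_def, ← ENNReal.ofReal_mul (hρ₀_pos x).le,
      ← ENNReal.ofReal_mul (hρ₁_pos y).le]
    congr 1
    have := (hρ₁_pos y).ne'
    field_simp
  have : IsSFiniteKernel ((Kernel.const (EuclideanSpace ℝ (Fin D)) m).withDensity f) :=
    Kernel.IsSFiniteKernel.withDensity _ fun _ _ => ENNReal.ofReal_ne_top
  set κ : Kernel (EuclideanSpace ℝ (Fin D)) (EuclideanSpace ℝ (Fin D)) :=
    (Kernel.const _ m).withDensity f with hκ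
  have hκ_apply : ∀ y, κ y = m.withDensity (f y) := fun y => Kernel.withDensity_apply _ hf y
  have : IsMarkovKernel κ := by
    refine ⟨fun y => ⟨?_⟩⟩
    have hfy : Measurable (f y) := hf.of_uncurry_left
    have hpos : ENNReal.ofReal (ρ₁ y) ≠ 0 := (ENNReal.ofReal_pos.2 (hρ₁_pos y)).ne'
    have h := hρ₁_lint y
    simp_rw [hqf] at h
    replace h := (lintegral_const_mul _ (ha.mul hfy)).symm.trans h
    rw [hκ_apply, withDensity_apply _ .univ, setLIntegral_univ, hm,
      lintegral_withDensity_eq_lintegral_mul _ ha hfy]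
    exact (ENNReal.mul_eq_left hpos ENNReal.ofReal_ne_top).1 h
  have hcomp := Measure.map_prodMk_eq_withDensity_compProd hXv hYv ha hρ₁_meas.ennreal_ofReal hf
    hjoint.ennreal_ofReal hqf hlaw
  have hYlaw : μ.map Yv = volume.withDensity fun y => ENNReal.ofReal (ρ₁ y) := by
    have h := congrArg Measure.fst hcomp
    rwa [Measure.fst_map_prodMk hXv, Measure.fst_compProd] at h
  have hY_ae : ∀ {p : EuclideanSpace ℝ (Fin D) → Prop}, (∀ᵐ y ∂(μ.map Yv), p y) ↔ ∀ᵐ y, p y := by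
    intro p
    rw [hYlaw, ae_withDensity_iff hρ₁_meas.ennreal_ofReal]
    simp [hρ₁_pos]
  have hcond : condDistrib Xv Yv μ =ᵐ[μ.map Yv] κ :=
    condDistrib_ae_eq_of_measure_eq_compProd Yv hXv.aemeasurable (by rw [hcomp, hYlaw])
  have hpmτ_meas : Measurable (Function.uncurry pmτ) := by
    have : Function.uncurry pmτ = fun p => ρ₀ p.2 * pτ p.2 p.1 / ρ₁ p.1 :=
      funext fun p => hpmτ_def p.2 p.1
    rw [this]
    exact (hjoint.comp measurable_swap).div (hρ₁_meas.comp measurable_fst)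
  have hdecomp : ∀ pD : EuclideanSpace ℝ (Fin d) → EuclideanSpace ℝ (Fin D) → ℝ,
      Measurable (Function.uncurry pD) →
      ((∀ᵐ p ∂((volume : Measure (EuclideanSpace ℝ (Fin D) × EuclideanSpace ℝ (Fin D))).withDensity
          (fun p => ENNReal.ofReal (ρ₁ p.1))), pmτ p.1 p.2 = pD (r p.1) p.2) ↔
        ∀ᵐ y ∂(μ.map Yv), ∀ᵐ x ∂m, pmτ y x = pD (r y) x) := by
    intro pD hpD
    have hset : MeasurableSet {p : EuclideanSpace ℝ (Fin D) × EuclideanSpace ℝ (Fin D) |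
        pmτ p.1 p.2 = pD (r p.1) p.2} :=
      measurableSet_eq_fun hpmτ_meas
        (hpD.comp ((hr.comp measurable_fst).prodMk measurable_snd))
    rw [ae_withDensity_iff (by fun_prop), hY_ae]
    simp only [ne_eq, ENNReal.ofReal_eq_zero, not_le, hρ₁_pos, forall_const, hm_ae]
    rw [Measure.volume_eq_prod, Measure.ae_prod_iff_ae_ae hset]
  constructor
  · intro h
    have hfac := hcond.symm.trans
      (condDistrib_ae_eq_comap_of_condExp_ae_eq hXv hYv hr fun t ht =>
        h (t.indicator fun _ => 1) (measurable_const.indicator ht)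
          ⟨1, fun x => by by_cases hx : x ∈ t <;> simp [hx]⟩)
    set η := condDistrib Xv (fun ω => r (Yv ω)) μ
    set g := η.rnDeriv (Kernel.const _ m)
    have hpD : Measurable (Function.uncurry fun z x => ρ₀ x * (g z x).toReal) :=
      (hρ₀_meas.comp measurable_snd).mul (η.measurable_rnDeriv _).ennreal_toReal
    refine ⟨fun z x => ρ₀ x * (g z x).toReal, hpD,
      fun z x => mul_nonneg (hρ₀_pos x).le ENNReal.toReal_nonneg, (hdecomp _ hpD).2 ?_⟩
    filter_upwards [hfac] with y hy
    rw [hκ_apply, Kernel.comap_apply] at hy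
    have h₁ : g (r y) =ᵐ[m] (η (r y)).rnDeriv m :=
      Kernel.rnDeriv_eq_rnDeriv_measure (κ := η) (η := Kernel.const _ m)
    rw [← hy] at h₁
    filter_upwards [h₁, Measure.rnDeriv_withDensity m (hf.of_uncurry_left (x := y))] with x h₁ h₂
    rw [h₁, h₂, hpmτ_def, hf_def, ENNReal.toReal_ofReal (div_nonneg (hpτ_nonneg x y) (hρ₁_pos y).le),
      mul_div_assoc]
  · rintro ⟨pD, hpD, -, hae⟩ h hh ⟨C, hC⟩
    rw [hdecomp pD hpD] at hae
    set g : EuclideanSpace ℝ (Fin d) → EuclideanSpace ℝ (Fin D) → ENNReal :=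
      fun z x => ENNReal.ofReal (pD z x / ρ₀ x) with hg_def
    have hg : Measurable (Function.uncurry g) :=
      (hpD.div (hρ₀_meas.comp measurable_snd)).ennreal_ofReal
    have : IsSFiniteKernel ((Kernel.const (EuclideanSpace ℝ (Fin d)) m).withDensity g) :=
      Kernel.IsSFiniteKernel.withDensity _ fun _ _ => ENNReal.ofReal_ne_top
    refine condExp_ae_eq_condExp_of_condDistrib_ae_eq_comap hXv hYv hr
      (η := (Kernel.const _ m).withDensity g) (hcond.trans ?_) hh.stronglyMeasurable
      (.of_bound (hh.comp hXv).aestronglyMeasurable C (ae_of_all _ fun ω => hC (Xv ω)))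
    filter_upwards [hae] with y hy
    rw [hκ_apply, Kernel.comap_apply, Kernel.withDensity_apply _ hg, Kernel.const_apply]
    refine withDensity_congr_ae ?_
    filter_upwards [hy] with x hx
    have := (hρ₀_pos x).ne'
    rw [hf_def, hg_def]
    dsimp only
    rw [← hx, hpmτ_def]
    congr 1
    field_simp
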